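/- Let q ∈ ℂ^× and m ∈ ℤ satisfy q⁴ ≠ 1 and, writing Q := q^m, Q² ≠ 1, Q² ≠ q², and q²Q² ≠ 1. Then there is a unique ℂ-algebra homomorphism Φ from the cyclotomic Hecke algebra H_n(q²; Q, Q^{−1}) to the blob algebra b_n(m) with Φ(T_i) = qU_i + q² for 1 ≤ i ≤ n−1 and Φ(L_1) = (q − q^{−1})U_0 + q^m, where U_0 := −[m]e. Moreover Φ is surjective and its kernel equals the two-sided ideal J_n of H_n(q²; Q, Q^{−1}) generated by the two elements e_2^{−1} := (T_1 − q²)(L_1 − Q^{−1})(L_2 − Q^{−1}) / ((1+q²)(Q − Q^{−1})(Q^{−1} − q^{−2}Q)) and e_2^{−2} := (T_1 − q²)(L_1 − Q)(L_2 − Q) / ((1+q²)(Q^{−1} − Q)(Q − q^{−2}Q^{−1})). Hence Φ induces a ℂ-algebra isomorphism H_n(q²; Q, Q^{−1})/J_n ≅ b_n(m). -/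

import Mathlib

noncomputable section

namespace Statement4

/-- The Gaussian integer `[j] = (q^j - q^{-j})/(q - q⁻¹)`. -/
def gauss (q : ℂ) (j : ℤ) : ℂ := (q ^ j - q ^ (-j)) / (q - q⁻¹)

/-- Generators of the blob algebra: `e` and `U_1, …, U_{n-1}` (0-indexed). -/
inductive BlobGen (n : ℕ) : Type
  | e : BlobGen n
  | U : Fin (n - 1) → BlobGen n

/-- The generator `e` in the free algebra. -/
def eF (n : ℕ) : FreeAlgebra ℂ (BlobGen n) := FreeAlgebra.ι ℂ BlobGen.e

/-- The generator `U_i` in the free algebra. -/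
def UF (n : ℕ) (i : Fin (n - 1)) : FreeAlgebra ℂ (BlobGen n) :=
  FreeAlgebra.ι ℂ (BlobGen.U i)

/-- The defining relations of the blob algebra `b_n(m)`; here `y_e = -[m-1]/[m]`. -/
inductive BlobRel (q : ℂ) (m : ℤ) (n : ℕ) :
    FreeAlgebra ℂ (BlobGen n) → FreeAlgebra ℂ (BlobGen n) → Prop
  | Usq (i : Fin (n - 1)) : BlobRel q m n (UF n i * UF n i) ((-(q + q⁻¹)) • UF n i)
  | UUU (i j : Fin (n - 1)) (h : i.val + 1 = j.val ∨ j.val + 1 = i.val) :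
      BlobRel q m n (UF n i * UF n j * UF n i) (UF n i)
  | Ucomm (i j : Fin (n - 1)) (h : i.val + 1 < j.val ∨ j.val + 1 < i.val) :
      BlobRel q m n (UF n i * UF n j) (UF n j * UF n i)
  | UeU (i : Fin (n - 1)) (h : i.val = 0) :
      BlobRel q m n (UF n i * eF n * UF n i) ((-(gauss q (m - 1) / gauss q m)) • UF n i)
  | ee : BlobRel q m n (eF n * eF n) (eF n)
  | Ue (i : Fin (n - 1)) (h : 1 ≤ i.val) : BlobRel q m n (UF n i * eF n) (eF n * UF n i)

/-- The blob algebra `b_n(m)`. -/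
abbrev Blob (q : ℂ) (m : ℤ) (n : ℕ) := RingQuot (BlobRel q m n)

/-- The image of `e` in the blob algebra. -/
def emk (q : ℂ) (m : ℤ) (n : ℕ) : Blob q m n :=
  RingQuot.mkAlgHom ℂ (BlobRel q m n) (eF n)

/-- The image of `U_i` in the blob algebra. -/
def Umk (q : ℂ) (m : ℤ) (n : ℕ) (i : Fin (n - 1)) : Blob q m n :=
  RingQuot.mkAlgHom ℂ (BlobRel q m n) (UF n i)

/-- The rescaled generator `U_0 = -[m]·e`. -/
def U0el (q : ℂ) (m : ℤ) (n : ℕ) : Blob q m n := (-(gauss q m)) • emk q m n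

/-- Generators of the cyclotomic Hecke algebra of type `G(2,1,n)`:
`L_1, …, L_n` and `T_1, …, T_{n-1}` (0-indexed). -/
inductive HGen (n : ℕ) : Type
  | L : Fin n → HGen n
  | T : Fin (n - 1) → HGen n

/-- The generator `L_r` in the free algebra. -/
def LF (n : ℕ) (r : Fin n) : FreeAlgebra ℂ (HGen n) := FreeAlgebra.ι ℂ (HGen.L r)

/-- The generator `T_r` in the free algebra. -/
def TF (n : ℕ) (r : Fin (n - 1)) : FreeAlgebra ℂ (HGen n) := FreeAlgebra.ι ℂ (HGen.T r)

/-- The position `r` as an element of `Fin n`. -/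
def lo {n : ℕ} (r : Fin (n - 1)) : Fin n := ⟨r.val, by have := r.2; omega⟩

/-- The position `r + 1` as an element of `Fin n`. -/
def hi {n : ℕ} (r : Fin (n - 1)) : Fin n := ⟨r.val + 1, by have := r.2; omega⟩

/-- The defining relations of the cyclotomic Hecke algebra `H_n(q₀; λ₁, λ₂)` of type
`G(2,1,n)`. -/
inductive HRel (q0 l1 l2 : ℂ) (n : ℕ) :
    FreeAlgebra ℂ (HGen n) → FreeAlgebra ℂ (HGen n) → Prop
  | cyclo (r : Fin n) (h : r.val = 0) :
      HRel q0 l1 l2 n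
        ((LF n r - algebraMap ℂ _ l1) * (LF n r - algebraMap ℂ _ l2)) 0
  | LL (r s : Fin n) : HRel q0 l1 l2 n (LF n r * LF n s) (LF n s * LF n r)
  | quad (r : Fin (n - 1)) :
      HRel q0 l1 l2 n ((TF n r + 1) * (TF n r - algebraMap ℂ _ q0)) 0
  | TLrel (r : Fin (n - 1)) :
      HRel q0 l1 l2 n (TF n r * LF n (lo r))
        (LF n (hi r) * (TF n r - algebraMap ℂ _ q0 + 1))
  | braid (r s : Fin (n - 1)) (h : s.val = r.val + 1) :
      HRel q0 l1 l2 n (TF n r * TF n s * TF n r) (TF n s * TF n r * TF n s)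
  | TLcomm (r : Fin (n - 1)) (s : Fin n) (h : r.val + 1 < s.val ∨ s.val + 1 < r.val) :
      HRel q0 l1 l2 n (TF n r * LF n s) (LF n s * TF n r)
  | TT (r s : Fin (n - 1)) (h : r.val + 1 < s.val ∨ s.val + 1 < r.val) :
      HRel q0 l1 l2 n (TF n r * TF n s) (TF n s * TF n r)

/-- The cyclotomic Hecke algebra `H_n(q₀; λ₁, λ₂)` of type `G(2,1,n)`. -/
abbrev Hcy (q0 l1 l2 : ℂ) (n : ℕ) := RingQuot (HRel q0 l1 l2 n)

/-- The image of `L_r` in the cyclotomic Hecke algebra. -/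
def Lmk (q0 l1 l2 : ℂ) (n : ℕ) (r : Fin n) : Hcy q0 l1 l2 n :=
  RingQuot.mkAlgHom ℂ (HRel q0 l1 l2 n) (LF n r)

/-- The image of `T_r` in the cyclotomic Hecke algebra. -/
def Tmk (q0 l1 l2 : ℂ) (n : ℕ) (r : Fin (n - 1)) : Hcy q0 l1 l2 n :=
  RingQuot.mkAlgHom ℂ (HRel q0 l1 l2 n) (TF n r)

/-- The parameter `Q = q^m`. -/
def Qp (q : ℂ) (m : ℤ) : ℂ := q ^ m

/-- The cyclotomic Hecke algebra `H_n(q²; Q, Q⁻¹)` with `Q = q^m`. -/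
abbrev Hm (q : ℂ) (m : ℤ) (n : ℕ) := Hcy (q ^ 2) (Qp q m) (Qp q m)⁻¹ n

/-- The idempotent `e₂⁻¹ = (T₁-q²)(L₁-Q⁻¹)(L₂-Q⁻¹)/((1+q²)(Q-Q⁻¹)(Q⁻¹-q⁻²Q))` of
`H_n(q²; Q, Q⁻¹)`, `n ≥ 2`. -/
def e21 (q : ℂ) (m : ℤ) (n : ℕ) (hn : 2 ≤ n) : Hm q m n :=
  ((1 + q ^ 2) * (Qp q m - (Qp q m)⁻¹) * ((Qp q m)⁻¹ - q ^ (-2 : ℤ) * Qp q m))⁻¹ •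
    ((Tmk (q ^ 2) (Qp q m) (Qp q m)⁻¹ n ⟨0, by omega⟩ - algebraMap ℂ _ (q ^ 2)) *
      (Lmk (q ^ 2) (Qp q m) (Qp q m)⁻¹ n ⟨0, by omega⟩ - algebraMap ℂ _ (Qp q m)⁻¹) *
      (Lmk (q ^ 2) (Qp q m) (Qp q m)⁻¹ n ⟨1, by omega⟩ - algebraMap ℂ _ (Qp q m)⁻¹))

/-- The idempotent `e₂⁻² = (T₁-q²)(L₁-Q)(L₂-Q)/((1+q²)(Q⁻¹-Q)(Q-q⁻²Q⁻¹))` of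
`H_n(q²; Q, Q⁻¹)`, `n ≥ 2`. -/
def e22 (q : ℂ) (m : ℤ) (n : ℕ) (hn : 2 ≤ n) : Hm q m n :=
  ((1 + q ^ 2) * ((Qp q m)⁻¹ - Qp q m) * (Qp q m - q ^ (-2 : ℤ) * (Qp q m)⁻¹))⁻¹ •
    ((Tmk (q ^ 2) (Qp q m) (Qp q m)⁻¹ n ⟨0, by omega⟩ - algebraMap ℂ _ (q ^ 2)) *
      (Lmk (q ^ 2) (Qp q m) (Qp q m)⁻¹ n ⟨0, by omega⟩ - algebraMap ℂ _ (Qp q m)) *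
      (Lmk (q ^ 2) (Qp q m) (Qp q m)⁻¹ n ⟨1, by omega⟩ - algebraMap ℂ _ (Qp q m)))

section
variable {A : Type*} [Ring A] [Algebra ℂ A]

theorem blob_tl_relation {u v e : A} {δ y : ℂ} (hδ : δ ≠ 0) (hy : y ≠ 0) (hyδ : y ≠ δ)
    (hu : u * u = δ • u) (hv : v * v = δ • v) (huv : u * v * u - u = v * u * v - v)
    (hueu : u * e * u = y • u) (he : e * e = e) (hve : v * e = e * v) : u * v * u = u := by
  obtain ⟨x, hx⟩ : ∃ x, x = u * v * u - u := ⟨_, rfl⟩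
  have hxu : x * u = δ • x := by
    rw [hx, sub_mul, mul_assoc (u * v), hu]; simp [smul_sub]
  have hxv : x * v = δ • x := by
    rw [hx, huv, sub_mul, mul_assoc (v * u), hv]; simp [smul_sub]
  have hxeu : x * e * u = y • x := by
    have h : δ • (x * e * u) = δ • (y • x) := by
      calc δ • (x * e * u) = x * (u * e * u) := by
            rw [← mul_assoc, ← mul_assoc, hxu]; simp
        _ = δ • (y • x) := by rw [hueu, mul_smul_comm, hxu, smul_comm]
    exact smul_right_injective A hδ h
  have hxev : x * e * v = δ • (x * e) := by
    rw [mul_assoc, ← hve, ← mul_assoc, hxv, smul_mul_assoc]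
  have hxe : δ • (x * e) = y • x := by
    have h := congrArg (fun z => x * e * z) huv
    simp only [mul_sub, ← mul_assoc, hxeu, hxev, smul_mul_assoc, hxu, hxv, smul_smul] at h
    linear_combination (norm := module) h
  have hxe0 : x * e = 0 := by
    have h := congrArg (fun z => z * e) hxe
    simp only [smul_mul_assoc, mul_assoc, he] at h
    have h' : (y - δ) • (x * e) = 0 := by rw [sub_smul, h, sub_self]
    exact (smul_eq_zero.mp h').resolve_left (sub_ne_zero.mpr hyδ)
  rw [hxe0, smul_zero] at hxe
  have hx0 := (smul_eq_zero.mp hxe.symm).resolve_left hy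
  rw [hx0] at hx
  exact (sub_eq_zero.mp hx.symm)

theorem hecke_quadratic {u : A} {q : ℂ} (hq : q ≠ 0) (hu : u * u = (-(q + q⁻¹)) • u) :
    (q • u + algebraMap ℂ A (q ^ 2) + 1) *
      (q • u + algebraMap ℂ A (q ^ 2) - algebraMap ℂ A (q ^ 2)) = 0 := by
  simp only [Algebra.algebraMap_eq_smul_one, add_mul, add_sub_cancel_right, smul_mul_assoc,
    mul_smul_comm, hu, one_mul]
  match_scalars
  field_simp
  ring

theorem hecke_braid {u v : A} {q : ℂ} (hq : q ≠ 0)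
    (hu : u * u = (-(q + q⁻¹)) • u) (hv : v * v = (-(q + q⁻¹)) • v)
    (huv : u * v * u = u) (hvu : v * u * v = v) :
    (q • u + algebraMap ℂ A (q ^ 2)) * (q • v + algebraMap ℂ A (q ^ 2)) *
      (q • u + algebraMap ℂ A (q ^ 2)) =
    (q • v + algebraMap ℂ A (q ^ 2)) * (q • u + algebraMap ℂ A (q ^ 2)) *
      (q • v + algebraMap ℂ A (q ^ 2)) := by
  simp only [Algebra.algebraMap_eq_smul_one, add_mul, mul_add, smul_mul_assoc, mul_smul_comm, hu,
    hv, huv, hvu, one_mul, mul_one]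
  match_scalars <;> field_simp <;> ring

theorem jucysMurphy_comm {u l : A} {q s : ℂ} (hl : l * l = s • l - 1)
    (hulu : u * l * u = (-(q * s)) • u) :
    l * ((q • u + algebraMap ℂ A (q ^ 2)) * l * (q • u + algebraMap ℂ A (q ^ 2))) =
    (q • u + algebraMap ℂ A (q ^ 2)) * l * (q • u + algebraMap ℂ A (q ^ 2)) * l := by
  have h1 : u * (l * u) = (-(q * s)) • u := by rw [← mul_assoc, hulu]
  have h2 : u * (l * l) = s • (u * l) - u := by rw [hl]; simp [mul_sub]
  have h3 : l * (l * u) = s • (l * u) - u := by rw [← mul_assoc, hl]; simp [sub_mul]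
  simp only [Algebra.algebraMap_eq_smul_one, add_mul, mul_add, smul_mul_assoc, mul_smul_comm,
    one_mul, mul_one,
    mul_assoc, h1, h2, h3]
  module

theorem blob_kills {u l : A} {q s a : ℂ} (hq : q ≠ 0) (hl : l * l = s • l - 1)
    (hu : u * u = (-(q + q⁻¹)) • u)
    (hulu : u * l * u = (-(q * s)) • u) (ha : a * a - s * a + 1 = 0) :
    u * (l - algebraMap ℂ A a) * ((q ^ 2)⁻¹ • ((q • u + algebraMap ℂ A (q ^ 2)) * l *
      (q • u + algebraMap ℂ A (q ^ 2))) - algebraMap ℂ A a) = 0 := by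
  have h1 : u * (l * u) = (-(q * s)) • u := by rw [← mul_assoc, hulu]
  have h2 : u * (l * l) = s • (u * l) - u := by rw [hl]; simp [mul_sub]
  have h3 : l * (l * u) = s • (l * u) - u := by rw [← mul_assoc, hl]; simp [sub_mul]
  have h4 : u * (l * (u * l)) = (-(q * s)) • (u * l) := by
    rw [← mul_assoc, ← mul_assoc, hulu, smul_mul_assoc]
  have h6 (x : A) : u * (u * x) = (-(q + q⁻¹)) • (u * x) := by
    rw [← mul_assoc, hu, smul_mul_assoc]
  simp only [Algebra.algebraMap_eq_smul_one, add_mul, mul_add, sub_mul, mul_sub, smul_mul_assoc,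
    mul_smul_comm, one_mul, mul_one, mul_assoc, h1, h2, h3, h4, h6, hu, smul_sub]
  match_scalars <;> field_simp <;> first | ring1 | linear_combination ha

theorem mul_quadratic {t : A} {c : ℂ} (h : (t + 1) * (t - algebraMap ℂ A c) = 0) :
    t * (t - algebraMap ℂ A c + 1) = algebraMap ℂ A c := by
  rw [← sub_eq_zero, ← h]
  noncomm_ring

theorem quadratic_mul {t : A} {c : ℂ} (h : (t + 1) * (t - algebraMap ℂ A c) = 0) :
    (t - algebraMap ℂ A c + 1) * t = algebraMap ℂ A c := by
  refine Eq.trans ?_ (mul_quadratic h)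
  simp only [add_mul, sub_mul, mul_add, mul_sub, one_mul, mul_one, Algebra.commutes c t]

theorem jucysMurphy_eq {t l l' : A} {c : ℂ} (hc : c ≠ 0)
    (h : (t + 1) * (t - algebraMap ℂ A c) = 0)
    (htl : t * l = l' * (t - algebraMap ℂ A c + 1)) : l' = c⁻¹ • (t * l * t) := by
  rw [htl, mul_assoc, quadratic_mul h, ← Algebra.commutes, ← Algebra.smul_def, smul_smul,
    inv_mul_cancel₀ hc, one_smul]

theorem isUnit_of_quadratic {t : A} {c : ℂ} (hc : c ≠ 0)
    (h : (t + 1) * (t - algebraMap ℂ A c) = 0) : IsUnit t := by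
  refine ⟨⟨t, c⁻¹ • (t - algebraMap ℂ A c + 1), ?_, ?_⟩, rfl⟩
  · rw [mul_smul_comm, mul_quadratic h, Algebra.smul_def, ← map_mul, inv_mul_cancel₀ hc, map_one]
  · rw [smul_mul_assoc, quadratic_mul h, Algebra.smul_def, ← map_mul, inv_mul_cancel₀ hc, map_one]

theorem comm_of_jucysMurphy_comm {t₁ t₂ l₁ l₃ : A} {c : ℂ} (hc : c ≠ 0)
    (ht₁ : IsUnit t₁) (ht₂ : IsUnit t₂) (hb : t₁ * t₂ * t₁ = t₂ * t₁ * t₂)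
    (hl₃ : l₃ = c⁻¹ • (t₂ * (c⁻¹ • (t₁ * l₁ * t₁)) * t₂)) (h : t₁ * l₃ = l₃ * t₁) :
    t₂ * l₁ = l₁ * t₂ := by
  rw [hl₃] at h
  simp only [mul_smul_comm, smul_mul_assoc] at h
  have h' := smul_right_injective A (inv_ne_zero hc) (smul_right_injective A (inv_ne_zero hc) h)
  apply ht₁.mul_right_cancel
  apply ht₂.mul_right_cancel
  apply ht₁.mul_left_cancel
  apply ht₂.mul_left_cancel
  calc t₂ * (t₁ * (t₂ * l₁ * t₁ * t₂)) = (t₂ * t₁ * t₂) * l₁ * t₁ * t₂ := by noncomm_ring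
    _ = t₁ * (t₂ * (t₁ * l₁ * t₁) * t₂) := by rw [← hb]; noncomm_ring
    _ = t₂ * t₁ * l₁ * (t₁ * t₂ * t₁) := by rw [h']; noncomm_ring
    _ = _ := by rw [hb]; noncomm_ring

theorem tl_of_braid {u v : A} {q : ℂ} (hq : q ≠ 0)
    (hu : u * u = (-(q + q⁻¹)) • u) (hv : v * v = (-(q + q⁻¹)) • v)
    (h : (q • u + algebraMap ℂ A (q ^ 2)) * (q • v + algebraMap ℂ A (q ^ 2)) *
      (q • u + algebraMap ℂ A (q ^ 2)) =
    (q • v + algebraMap ℂ A (q ^ 2)) * (q • u + algebraMap ℂ A (q ^ 2)) *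
      (q • v + algebraMap ℂ A (q ^ 2))) : u * v * u - u = v * u * v - v := by
  have hq3 : q ^ 3 ≠ 0 := pow_ne_zero 3 hq
  apply smul_right_injective A hq3
  simp only [Algebra.algebraMap_eq_smul_one, add_mul, mul_add, smul_mul_assoc, mul_smul_comm,
    hu, hv, one_mul, mul_one] at h
  simp only [smul_sub]
  rw [← sub_eq_zero] at h ⊢
  rw [← h]
  match_scalars <;> field_simp <;> ring

theorem tl_mul_mul_conj {u v w : A} {q : ℂ} (hq : q ≠ 0) (t : A → A)
    (ht : ∀ x, t x = q • x + algebraMap ℂ A (q ^ 2))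
    (hg : IsUnit (t u * t v * t w)) (huv : t u * t v * t u = t v * t u * t v)
    (hvw : t v * t w * t v = t w * t v * t w) (huw : t u * t w = t w * t u)
    (h : u * v * u = u) : v * w * v = v := by
  obtain ⟨g, hgdef⟩ : ∃ g, g = t u * t v * t w := ⟨_, rfl⟩
  rw [← hgdef] at hg
  have key (x y : A) (hxy : g * t x = t y * g) : g * x = y * g := by
    rw [ht, ht] at hxy
    rw [mul_add, add_mul, Algebra.commutes, add_left_inj, mul_smul_comm, smul_mul_assoc] at hxy
    exact smul_right_injective A hq hxy
  have h1 : g * u = v * g := by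
    apply key
    calc g * t u = t u * t v * (t w * t u) := by rw [hgdef]; noncomm_ring
      _ = (t u * t v * t u) * t w := by rw [← huw]; noncomm_ring
      _ = _ := by rw [huv, hgdef]; noncomm_ring
  have h2 : g * v = w * g := by
    apply key
    calc g * t v = t u * (t v * t w * t v) := by rw [hgdef]; noncomm_ring
      _ = (t u * t w) * t v * t w := by rw [hvw]; noncomm_ring
      _ = _ := by rw [huw, hgdef]; noncomm_ring
  apply hg.mul_right_cancel
  calc v * w * v * g = v * w * (g * u) := by rw [h1]; noncomm_ring
    _ = v * (g * v) * u := by rw [h2]; noncomm_ring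
    _ = (g * u) * v * u := by rw [h1]; noncomm_ring
    _ = g * (u * v * u) := by noncomm_ring
    _ = v * g := by rw [h, h1]

theorem mul_mul_of_kills {u l : A} {q a b : ℂ} (hq : q ≠ 0) (hab : a ≠ b)
    (hu : u * u = (-(q + q⁻¹)) • u) {l' : A}
    (hl' : l' = (q ^ 2)⁻¹ • ((q • u + algebraMap ℂ A (q ^ 2)) * l *
      (q • u + algebraMap ℂ A (q ^ 2))))
    (ha : u * (l - algebraMap ℂ A a) * (l' - algebraMap ℂ A a) = 0)
    (hb : u * (l - algebraMap ℂ A b) * (l' - algebraMap ℂ A b) = 0) :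
    u * l * u = (-(q * (a + b))) • u := by
  have h6 (x : A) : u * (u * x) = (-(q + q⁻¹)) • (u * x) := by
    rw [← mul_assoc, hu, smul_mul_assoc]
  have h1 : u * l' = (-q⁻¹) • (u * (l * u)) - u * l := by
    rw [hl']
    simp only [Algebra.algebraMap_eq_smul_one, add_mul, mul_add, smul_mul_assoc, mul_smul_comm,
      one_mul, mul_one, mul_assoc, h6]
    match_scalars <;> field_simp <;> ring
  have h2 := ha.trans hb.symm
  simp only [Algebra.algebraMap_eq_smul_one, sub_mul, mul_sub, smul_mul_assoc, mul_smul_comm,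
    mul_one, mul_assoc, h1] at h2
  have h3 : (q⁻¹ * (a - b)) • (u * l * u) = (q⁻¹ * (a - b)) • ((-(q * (a + b))) • u) := by
    rw [mul_assoc]
    rw [← sub_eq_zero] at h2 ⊢
    rw [← h2]
    match_scalars <;> field_simp <;> ring
  exact smul_right_injective A (mul_ne_zero (inv_ne_zero hq) (sub_ne_zero.mpr hab)) h3

variable {t l : ℕ → A} {c : ℂ} (hl : ∀ k, l (k + 1) = c • (t k * l k * t k))
  (htt : ∀ i j, i + 1 < j → t i * t j = t j * t i)
  (htl : ∀ i, 1 ≤ i → t i * l 0 = l 0 * t i)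
include hl htt htl

theorem commute_jucysMurphy_of_lt : ∀ k i, k < i → Commute (t i) (l k)
  | 0, i, h => htl i h
  | k + 1, i, h => by
    rw [hl]
    have h1 : Commute (t i) (t k) := (htt k i h).symm
    have h2 := commute_jucysMurphy_of_lt k i (by omega)
    exact ((h1.mul_right h2).mul_right h1).smul_right c

variable {N : ℕ} (hb : ∀ i, i + 1 < N → t i * t (i + 1) * t i = t (i + 1) * t i * t (i + 1))
include hb

theorem commute_jucysMurphy_of_gt {i : ℕ} (hi : i + 1 < N) {k : ℕ} (hk : i + 2 ≤ k) :
    Commute (t i) (l k) := by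
  induction k, hk using Nat.le_induction with
  | base =>
    rw [hl, hl]
    simp only [mul_smul_comm, smul_mul_assoc]
    refine (Commute.smul_right ?_ c).smul_right c
    have h := (commute_jucysMurphy_of_lt hl htt htl i (i + 1) (by omega)).eq
    have hb := hb i hi
    obtain ⟨x, hx⟩ : ∃ x, x = t i := ⟨_, rfl⟩
    obtain ⟨y, hy⟩ : ∃ y, y = t (i + 1) := ⟨_, rfl⟩
    rw [← hx, ← hy] at hb ⊢
    rw [← hy] at h
    calc x * (y * (x * l i * x) * y) = (x * y * x) * l i * x * y := by noncomm_ring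
      _ = y * x * (y * l i) * x * y := by rw [hb]; noncomm_ring
      _ = y * x * l i * (y * x * y) := by rw [h]; noncomm_ring
      _ = _ := by rw [← hb]; noncomm_ring
  | succ k hk ih =>
    rw [hl]
    have h1 : Commute (t i) (t k) := htt i k (by omega)
    exact ((h1.mul_right ih).mul_right h1).smul_right c

theorem commute_jucysMurphy (h01 : Commute (l 0) (l 1)) {j : ℕ} :
    ∀ {k : ℕ}, j < k → k ≤ N → Commute (l j) (l k) := by
  induction j with
  | zero =>
    intro k hk hkN
    induction k, hk using Nat.le_induction with
    | base => exact h01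
    | succ k hk ih =>
      rw [hl]
      have h1 : Commute (l 0) (t k) := (htl k hk).symm
      exact ((h1.mul_right (ih (by omega))).mul_right h1).smul_right c
  | succ j ih =>
    intro k hk hkN
    rw [hl j]
    have h1 := commute_jucysMurphy_of_gt hl htt htl hb (i := j) (k := k) (by omega) (by omega)
    exact ((h1.mul_left (ih (by omega) hkN)).mul_left h1).smul_left c
end

theorem q_sub_inv_ne_zero {q : ℂ} (hq : q ≠ 0) (hq4 : q ^ 4 ≠ 1) : q - q⁻¹ ≠ 0 := by
  intro h
  field_simp at h
  exact hq4 (by linear_combination (q ^ 2 + 1) * h)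

theorem gauss_mul {q : ℂ} (hq : q ≠ 0) (hq4 : q ^ 4 ≠ 1) (j : ℤ) :
    (q - q⁻¹) * gauss q j = q ^ j - (q ^ j)⁻¹ := by
  have h := q_sub_inv_ne_zero hq hq4
  rw [gauss, zpow_neg, mul_div_cancel₀ _ h]

theorem Qp_sub_inv_ne_zero {q : ℂ} {m : ℤ} (hq : q ≠ 0) (hQ1 : (Qp q m) ^ 2 ≠ 1) :
    Qp q m - (Qp q m)⁻¹ ≠ 0 := by
  have hQ : Qp q m ≠ 0 := zpow_ne_zero m hq
  intro h
  apply hQ1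
  field_simp at h
  linear_combination h

theorem gauss_ratio {q : ℂ} {m : ℤ} (hq : q ≠ 0) (hq4 : q ^ 4 ≠ 1) :
    gauss q (m - 1) / gauss q m =
      (Qp q m * q⁻¹ - (Qp q m)⁻¹ * q) / (Qp q m - (Qp q m)⁻¹) := by
  have h := q_sub_inv_ne_zero hq hq4
  rw [← mul_div_mul_left _ _ h, gauss_mul hq hq4, gauss_mul hq hq4, zpow_sub_one₀ hq, Qp,
    mul_inv, inv_inv]

section BlobRelations
variable (q : ℂ) (m : ℤ) (n : ℕ)

theorem Umk_sq (i : Fin (n - 1)) : Umk q m n i * Umk q m n i = (-(q + q⁻¹)) • Umk q m n i := by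
  simpa [Umk] using RingQuot.mkAlgHom_rel ℂ (BlobRel.Usq (q := q) (m := m) i)

theorem Umk_mul_mul (i j : Fin (n - 1)) (h : i.val + 1 = j.val ∨ j.val + 1 = i.val) :
    Umk q m n i * Umk q m n j * Umk q m n i = Umk q m n i := by
  simpa [Umk] using RingQuot.mkAlgHom_rel ℂ (BlobRel.UUU (q := q) (m := m) i j h)

theorem Umk_comm (i j : Fin (n - 1)) (h : i.val + 1 < j.val ∨ j.val + 1 < i.val) :
    Umk q m n i * Umk q m n j = Umk q m n j * Umk q m n i := by
  simpa [Umk] using RingQuot.mkAlgHom_rel ℂ (BlobRel.Ucomm (q := q) (m := m) i j h)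

theorem Umk_emk_Umk (i : Fin (n - 1)) (h : i.val = 0) :
    Umk q m n i * emk q m n * Umk q m n i =
      (-(gauss q (m - 1) / gauss q m)) • Umk q m n i := by
  simpa only [Umk, emk, map_mul, map_smul] using
    RingQuot.mkAlgHom_rel ℂ (BlobRel.UeU (q := q) (m := m) i h)

theorem emk_sq : emk q m n * emk q m n = emk q m n := by
  simpa [emk] using RingQuot.mkAlgHom_rel ℂ (BlobRel.ee (q := q) (m := m) (n := n))

theorem Umk_emk_comm (i : Fin (n - 1)) (h : 1 ≤ i.val) :
    Umk q m n i * emk q m n = emk q m n * Umk q m n i := by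
  simpa [Umk, emk] using RingQuot.mkAlgHom_rel ℂ (BlobRel.Ue (q := q) (m := m) i h)

end BlobRelations

section HeckeRelations
variable (q0 l1 l2 : ℂ) (n : ℕ)

theorem Lmk_cyclo (r : Fin n) (h : r.val = 0) :
    (Lmk q0 l1 l2 n r - algebraMap ℂ _ l1) * (Lmk q0 l1 l2 n r - algebraMap ℂ _ l2) = 0 := by
  simpa only [Tmk, Lmk, map_mul, map_sub, AlgHom.commutes, map_zero] using
    RingQuot.mkAlgHom_rel ℂ (HRel.cyclo (q0 := q0) (l1 := l1) (l2 := l2) r h)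

theorem Tmk_quadratic (r : Fin (n - 1)) :
    (Tmk q0 l1 l2 n r + 1) * (Tmk q0 l1 l2 n r - algebraMap ℂ _ q0) = 0 := by
  simpa only [Tmk, Lmk, map_mul, map_sub, map_add, map_one, AlgHom.commutes, map_zero] using
    RingQuot.mkAlgHom_rel ℂ (HRel.quad (q0 := q0) (l1 := l1) (l2 := l2) r)

theorem Tmk_mul_Lmk (r : Fin (n - 1)) :
    Tmk q0 l1 l2 n r * Lmk q0 l1 l2 n (lo r) =
      Lmk q0 l1 l2 n (hi r) * (Tmk q0 l1 l2 n r - algebraMap ℂ _ q0 + 1) := by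
  simpa only [Tmk, Lmk, map_mul, map_sub, map_add, map_one, AlgHom.commutes] using
    RingQuot.mkAlgHom_rel ℂ (HRel.TLrel (q0 := q0) (l1 := l1) (l2 := l2) r)

theorem Tmk_braid (r s : Fin (n - 1)) (h : s.val = r.val + 1) :
    Tmk q0 l1 l2 n r * Tmk q0 l1 l2 n s * Tmk q0 l1 l2 n r =
      Tmk q0 l1 l2 n s * Tmk q0 l1 l2 n r * Tmk q0 l1 l2 n s := by
  simpa only [Tmk, Lmk, map_mul] using
    RingQuot.mkAlgHom_rel ℂ (HRel.braid (q0 := q0) (l1 := l1) (l2 := l2) r s h)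

theorem Tmk_Lmk_comm (r : Fin (n - 1)) (s : Fin n) (h : r.val + 1 < s.val ∨ s.val + 1 < r.val) :
    Tmk q0 l1 l2 n r * Lmk q0 l1 l2 n s = Lmk q0 l1 l2 n s * Tmk q0 l1 l2 n r := by
  simpa only [Tmk, Lmk, map_mul] using
    RingQuot.mkAlgHom_rel ℂ (HRel.TLcomm (q0 := q0) (l1 := l1) (l2 := l2) r s h)

theorem Tmk_comm (r s : Fin (n - 1)) (h : r.val + 1 < s.val ∨ s.val + 1 < r.val) :
    Tmk q0 l1 l2 n r * Tmk q0 l1 l2 n s = Tmk q0 l1 l2 n s * Tmk q0 l1 l2 n r := by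
  simpa only [Tmk, Lmk, map_mul] using
    RingQuot.mkAlgHom_rel ℂ (HRel.TT (q0 := q0) (l1 := l1) (l2 := l2) r s h)

variable {q0 l1 l2 n}

theorem Lmk_succ (hq0 : q0 ≠ 0) (r : ℕ) (hr : r + 1 < n) :
    Lmk q0 l1 l2 n ⟨r + 1, hr⟩ = q0⁻¹ • (Tmk q0 l1 l2 n ⟨r, by omega⟩ *
      Lmk q0 l1 l2 n ⟨r, by omega⟩ * Tmk q0 l1 l2 n ⟨r, by omega⟩) :=
  jucysMurphy_eq hq0 (Tmk_quadratic q0 l1 l2 n ⟨r, by omega⟩)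
    (Tmk_mul_Lmk q0 l1 l2 n ⟨r, by omega⟩)

theorem Tmk_Lmk_zero_comm (hq0 : q0 ≠ 0) (r : Fin (n - 1)) (hr : 1 ≤ r.val) :
    Tmk q0 l1 l2 n r * Lmk q0 l1 l2 n ⟨0, by omega⟩ =
      Lmk q0 l1 l2 n ⟨0, by omega⟩ * Tmk q0 l1 l2 n r := by
  obtain ⟨r, hrn⟩ := r
  obtain rfl | hr1 : r = 1 ∨ 1 < r := by simp only at hr; omega
  · refine comm_of_jucysMurphy_comm hq0
      (isUnit_of_quadratic hq0 (Tmk_quadratic q0 l1 l2 n ⟨0, by omega⟩))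
      (isUnit_of_quadratic hq0 (Tmk_quadratic q0 l1 l2 n _))
      (Tmk_braid q0 l1 l2 n _ _ rfl) ?_
      (Tmk_Lmk_comm q0 l1 l2 n ⟨0, by omega⟩ ⟨2, by omega⟩ (by simp))
    rw [Lmk_succ hq0, Lmk_succ hq0]
  · exact Tmk_Lmk_comm q0 l1 l2 n _ _ (Or.inr (by simpa using hr1))

end HeckeRelations

theorem algHom_Hcy_ext {q0 l1 l2 : ℂ} {n : ℕ} (hq0 : q0 ≠ 0) (hn : 0 < n) {B : Type*} [Ring B]
    [Algebra ℂ B] {f g : Hcy q0 l1 l2 n →ₐ[ℂ] B}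
    (hT : ∀ i, f (Tmk q0 l1 l2 n i) = g (Tmk q0 l1 l2 n i))
    (hL : f (Lmk q0 l1 l2 n ⟨0, hn⟩) = g (Lmk q0 l1 l2 n ⟨0, hn⟩)) : f = g := by
  have hL' : ∀ (r : ℕ) (hr : r < n), f (Lmk q0 l1 l2 n ⟨r, hr⟩) = g (Lmk q0 l1 l2 n ⟨r, hr⟩) := by
    intro r
    induction r with
    | zero => exact fun _ => hL
    | succ r ih =>
      intro hr
      rw [Lmk_succ hq0 r hr]
      simp only [map_smul, map_mul, hT, ih]
  apply RingQuot.ringQuot_ext'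
  apply FreeAlgebra.hom_ext
  funext x
  cases x with
  | L r => exact hL' r.val r.isLt
  | T i => exact hT i

/-- The images in the blob algebra of the generators `T_i`, extended by `1`. -/
def blobT (q : ℂ) (m : ℤ) (n : ℕ) (i : ℕ) : Blob q m n :=
  if h : i < n - 1 then q • Umk q m n ⟨i, h⟩ + algebraMap ℂ _ (q ^ 2) else 1

/-- The images in the blob algebra of the Jucys–Murphy generators. -/
def blobL (q : ℂ) (m : ℤ) (n : ℕ) : ℕ → Blob q m n
  | 0 => (q - q⁻¹) • U0el q m n + algebraMap ℂ _ (q ^ m)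
  | k + 1 => (q ^ 2)⁻¹ • (blobT q m n k * blobL q m n k * blobT q m n k)

section HeckeToBlob
variable {q : ℂ} {m : ℤ} {n : ℕ}

theorem blobT_of_lt {i : ℕ} (h : i < n - 1) :
    blobT q m n i = q • Umk q m n ⟨i, h⟩ + algebraMap ℂ _ (q ^ 2) := dif_pos h

theorem blobL_zero_eq (hq : q ≠ 0) (hq4 : q ^ 4 ≠ 1) :
    blobL q m n 0 = algebraMap ℂ _ (Qp q m) - (Qp q m - (Qp q m)⁻¹) • emk q m n := by
  rw [blobL, U0el, smul_smul, mul_neg, gauss_mul hq hq4, Qp, neg_smul]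
  abel

theorem blobL_zero_sq (hq : q ≠ 0) (hq4 : q ^ 4 ≠ 1) :
    blobL q m n 0 * blobL q m n 0 = (Qp q m + (Qp q m)⁻¹) • blobL q m n 0 - 1 := by
  have hQ : Qp q m ≠ 0 := zpow_ne_zero m hq
  rw [blobL_zero_eq hq hq4]
  simp only [Algebra.algebraMap_eq_smul_one, sub_mul, mul_sub, smul_mul_assoc, mul_smul_comm,
    one_mul, mul_one, emk_sq]
  match_scalars <;> field_simp <;> ring

theorem Umk_blobL_zero_Umk (hq : q ≠ 0) (hq4 : q ^ 4 ≠ 1) (hQ1 : (Qp q m) ^ 2 ≠ 1)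
    (h : 0 < n - 1) :
    Umk q m n ⟨0, h⟩ * blobL q m n 0 * Umk q m n ⟨0, h⟩ =
      (-(q * (Qp q m + (Qp q m)⁻¹))) • Umk q m n ⟨0, h⟩ := by
  have hQ : Qp q m ≠ 0 := zpow_ne_zero m hq
  have hQQ := Qp_sub_inv_ne_zero hq hQ1
  rw [blobL_zero_eq hq hq4, Algebra.algebraMap_eq_smul_one]
  simp only [sub_mul, mul_sub, smul_mul_assoc, mul_smul_comm, mul_one, Umk_sq, Umk_emk_Umk,
    gauss_ratio hq hq4, smul_smul, ← sub_smul]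
  congr 1
  have h := mul_div_cancel₀ (Qp q m * q⁻¹ - (Qp q m)⁻¹ * q) hQQ
  linear_combination h

theorem blobT_comm (i j : ℕ) (hij : i + 1 < j) :
    blobT q m n i * blobT q m n j = blobT q m n j * blobT q m n i := by
  by_cases hj : j < n - 1
  · rw [blobT_of_lt hj, blobT_of_lt (i := i) (by omega)]
    have h : Commute (Umk q m n ⟨i, by omega⟩) (Umk q m n ⟨j, hj⟩) :=
      Umk_comm q m n _ _ (Or.inl hij)
    exact (((h.smul_right q).smul_left q).add_left (Algebra.commute_algebraMap_left _ _)).add_right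
      (Algebra.commute_algebraMap_right _ _)
  · simp [blobT, hj]

theorem blobT_blobL_zero_comm (hq : q ≠ 0) (hq4 : q ^ 4 ≠ 1) (i : ℕ) (hi : 1 ≤ i) :
    blobT q m n i * blobL q m n 0 = blobL q m n 0 * blobT q m n i := by
  by_cases h : i < n - 1
  · rw [blobT_of_lt h, blobL_zero_eq hq hq4]
    have h : Commute (Umk q m n ⟨i, h⟩) (emk q m n) := Umk_emk_comm q m n _ hi
    exact (Algebra.commute_algebraMap_right _ _).sub_right
      (((h.smul_right _).smul_left q).add_left (Algebra.commute_algebraMap_left _ _))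
  · simp [blobT, h]

theorem blobT_braid (hq : q ≠ 0) (i : ℕ) (hi : i + 1 < n - 1) :
    blobT q m n i * blobT q m n (i + 1) * blobT q m n i =
      blobT q m n (i + 1) * blobT q m n i * blobT q m n (i + 1) := by
  rw [blobT_of_lt hi, blobT_of_lt (i := i) (by omega)]
  exact hecke_braid hq (Umk_sq ..) (Umk_sq ..) (Umk_mul_mul _ _ _ _ _ (Or.inl rfl))
    (Umk_mul_mul _ _ _ _ _ (Or.inr rfl))

theorem blobL_comm (hq : q ≠ 0) (hq4 : q ^ 4 ≠ 1) (hQ1 : (Qp q m) ^ 2 ≠ 1) {j k : ℕ}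
    (hjk : j < k) (hk : k ≤ n - 1) : Commute (blobL q m n j) (blobL q m n k) := by
  refine commute_jucysMurphy (t := blobT q m n) (fun _ => rfl) blobT_comm
    (blobT_blobL_zero_comm hq hq4) (blobT_braid hq) ?_ hjk hk
  refine Commute.smul_right ?_ _
  rw [blobT_of_lt (i := 0) (by omega)]
  exact jucysMurphy_comm (blobL_zero_sq hq hq4) (Umk_blobL_zero_Umk hq hq4 hQ1 _)

/-- The values of the homomorphism from the Hecke algebra to the blob algebra on generators. -/
def blobImage (q : ℂ) (m : ℤ) (n : ℕ) : HGen n → Blob q m n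
  | HGen.L r => blobL q m n r
  | HGen.T i => blobT q m n i

theorem blobImage_rel (hq : q ≠ 0) (hq4 : q ^ 4 ≠ 1) (hQ1 : (Qp q m) ^ 2 ≠ 1)
    ⦃x y : FreeAlgebra ℂ (HGen n)⦄ (h : HRel (q ^ 2) (Qp q m) (Qp q m)⁻¹ n x y) :
    FreeAlgebra.lift ℂ (blobImage q m n) x = FreeAlgebra.lift ℂ (blobImage q m n) y := by
  have hQ : Qp q m ≠ 0 := zpow_ne_zero m hq
  have hq2 : q ^ 2 ≠ 0 := pow_ne_zero 2 hq
  have hTquad (r : Fin (n - 1)) :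
      (blobT q m n r + 1) * (blobT q m n r - algebraMap ℂ _ (q ^ 2)) = 0 := by
    rw [blobT_of_lt r.isLt]
    exact hecke_quadratic hq (Umk_sq ..)
  induction h <;> simp only [LF, TF, map_mul, map_sub, map_add, map_one, map_zero,
    FreeAlgebra.lift_ι_apply, AlgHom.commutes, blobImage]
  case cyclo r h =>
    rw [h]
    have h := blobL_zero_sq (m := m) (n := n) hq hq4
    simp only [Algebra.algebraMap_eq_smul_one, sub_mul, mul_sub, smul_mul_assoc, mul_smul_comm,
      one_mul, mul_one, h]
    match_scalars <;> field_simp <;> ring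
  case LL r s =>
    rcases lt_trichotomy r s with h | rfl | h
    · exact blobL_comm hq hq4 hQ1 h (by omega)
    · rfl
    · exact (blobL_comm hq hq4 hQ1 h (by omega)).symm
  case quad r => exact hTquad r
  case TLrel r =>
    simp only [lo, hi, blobL]
    rw [smul_mul_assoc, mul_assoc _ _ (_ + _), mul_quadratic (hTquad r), ← Algebra.commutes,
      ← Algebra.smul_def, smul_smul, inv_mul_cancel₀ hq2, one_smul]
  case braid r s h =>
    rw [h]
    exact blobT_braid hq r (by omega)
  case TLcomm r s h =>
    rcases h with h | h
    · exact commute_jucysMurphy_of_gt (t := blobT q m n) (fun _ => rfl) blobT_comm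
        (blobT_blobL_zero_comm hq hq4) (blobT_braid hq) (by omega) (by omega)
    · exact commute_jucysMurphy_of_lt (t := blobT q m n) (fun _ => rfl) blobT_comm
        (blobT_blobL_zero_comm hq hq4) _ _ (by omega)
  case TT r s h =>
    rcases h with h | h
    · exact blobT_comm _ _ h
    · exact (blobT_comm _ _ h).symm

/-- The homomorphism from the cyclotomic Hecke algebra to the blob algebra. -/
def heckeToBlob (hq : q ≠ 0) (hq4 : q ^ 4 ≠ 1) (hQ1 : (Qp q m) ^ 2 ≠ 1) :
    Hm q m n →ₐ[ℂ] Blob q m n :=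
  RingQuot.liftAlgHom ℂ ⟨FreeAlgebra.lift ℂ (blobImage q m n), blobImage_rel hq hq4 hQ1⟩

variable (hq : q ≠ 0) (hq4 : q ^ 4 ≠ 1) (hQ1 : (Qp q m) ^ 2 ≠ 1)

theorem heckeToBlob_T (i : Fin (n - 1)) :
    heckeToBlob hq hq4 hQ1 (Tmk (q ^ 2) (Qp q m) (Qp q m)⁻¹ n i) = blobT q m n i := by
  simp [heckeToBlob, Tmk, TF, blobImage]

theorem heckeToBlob_L (r : Fin n) :
    heckeToBlob hq hq4 hQ1 (Lmk (q ^ 2) (Qp q m) (Qp q m)⁻¹ n r) = blobL q m n r := by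
  simp [heckeToBlob, Lmk, LF, blobImage]

theorem heckeToBlob_kills (hn : 2 ≤ n) {a : ℂ}
    (ha : a * a - (Qp q m + (Qp q m)⁻¹) * a + 1 = 0) (d : ℂ) :
    heckeToBlob hq hq4 hQ1 (d • ((Tmk (q ^ 2) (Qp q m) (Qp q m)⁻¹ n ⟨0, by omega⟩ -
        algebraMap ℂ _ (q ^ 2)) *
      (Lmk (q ^ 2) (Qp q m) (Qp q m)⁻¹ n ⟨0, by omega⟩ - algebraMap ℂ _ a) *
      (Lmk (q ^ 2) (Qp q m) (Qp q m)⁻¹ n ⟨1, by omega⟩ - algebraMap ℂ _ a))) = 0 := by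
  have h := blob_kills hq (blobL_zero_sq hq hq4) (Umk_sq q m n _)
    (Umk_blobL_zero_Umk hq hq4 hQ1 (by omega)) ha
  rw [← blobT_of_lt] at h
  simp only [map_smul, map_mul, map_sub, AlgHom.commutes, heckeToBlob_T, heckeToBlob_L]
  rw [blobT_of_lt (by omega), add_sub_cancel_right, smul_mul_assoc, smul_mul_assoc]
  exact (congrArg (fun z => d • q • z) h).trans (by simp)

theorem heckeToBlob_e21 (hn : 2 ≤ n) : heckeToBlob hq hq4 hQ1 (e21 q m n hn) = 0 := by
  have hQ : Qp q m ≠ 0 := zpow_ne_zero m hq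
  exact heckeToBlob_kills hq hq4 hQ1 hn (by field_simp; ring) _

theorem heckeToBlob_e22 (hn : 2 ≤ n) : heckeToBlob hq hq4 hQ1 (e22 q m n hn) = 0 := by
  have hQ : Qp q m ≠ 0 := zpow_ne_zero m hq
  exact heckeToBlob_kills hq hq4 hQ1 hn (by field_simp; ring) _

end HeckeToBlob

section BlobToQuotient
variable {q : ℂ} {m : ℤ} {n : ℕ} {A : Type*} [Ring A] [Algebra ℂ A]

theorem one_add_q_sq_ne_zero (hq4 : q ^ 4 ≠ 1) : 1 + q ^ 2 ≠ 0 := by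
  intro h
  exact hq4 (by linear_combination (q ^ 2 - 1) * h)

/-- The image of the Temperley–Lieb generator `U_i` under a homomorphism out of the Hecke
algebra, namely `q⁻¹ (T_i - q²)`. -/
def tlImage (f : Hm q m n →ₐ[ℂ] A) (i : Fin (n - 1)) : A :=
  q⁻¹ • (f (Tmk (q ^ 2) (Qp q m) (Qp q m)⁻¹ n i) - algebraMap ℂ A (q ^ 2))

/-- The image of the blob generator `e` under a homomorphism out of the Hecke algebra, namely
`(Q - L₁) / (Q - Q⁻¹)`. -/
def idemImage (hn : 2 ≤ n) (f : Hm q m n →ₐ[ℂ] A) : A :=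
  (Qp q m - (Qp q m)⁻¹)⁻¹ • (algebraMap ℂ A (Qp q m) -
    f (Lmk (q ^ 2) (Qp q m) (Qp q m)⁻¹ n ⟨0, by omega⟩))

variable (f : Hm q m n →ₐ[ℂ] A)

theorem map_Tmk (hq : q ≠ 0) (i : Fin (n - 1)) :
    f (Tmk (q ^ 2) (Qp q m) (Qp q m)⁻¹ n i) =
      q • tlImage f i + algebraMap ℂ A (q ^ 2) := by
  rw [tlImage, smul_smul, mul_inv_cancel₀ hq, one_smul, sub_add_cancel]

theorem map_Lmk_zero (hn : 2 ≤ n) (hq : q ≠ 0) (hQ1 : (Qp q m) ^ 2 ≠ 1) :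
    f (Lmk (q ^ 2) (Qp q m) (Qp q m)⁻¹ n ⟨0, by omega⟩) =
      algebraMap ℂ A (Qp q m) - (Qp q m - (Qp q m)⁻¹) • idemImage hn f := by
  rw [idemImage, smul_smul, mul_inv_cancel₀ (Qp_sub_inv_ne_zero hq hQ1), one_smul, sub_sub_cancel]

theorem tlImage_sq (hq : q ≠ 0) (i : Fin (n - 1)) :
    tlImage f i * tlImage f i = (-(q + q⁻¹)) • tlImage f i := by
  have h := congrArg f (Tmk_quadratic (q ^ 2) (Qp q m) (Qp q m)⁻¹ n i)
  simp only [map_mul, map_add, map_sub, map_one, map_zero, AlgHom.commutes, map_Tmk f hq,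
    add_sub_cancel_right] at h
  have h2 : (q ^ 2) • (tlImage f i * tlImage f i) =
      (q ^ 2) • ((-(q + q⁻¹)) • tlImage f i) := by
    rw [← sub_eq_zero, ← h]
    simp only [Algebra.algebraMap_eq_smul_one, add_mul, smul_mul_assoc, mul_smul_comm, one_mul]
    match_scalars <;> field_simp
  exact smul_right_injective A (pow_ne_zero 2 hq) h2

theorem commute_tlImage {x : A} {i : Fin (n - 1)}
    (h : Commute (f (Tmk (q ^ 2) (Qp q m) (Qp q m)⁻¹ n i)) x) : Commute (tlImage f i) x :=
  (h.sub_left (Algebra.commute_algebraMap_left _ _)).smul_left _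

theorem tlImage_comm (i j : Fin (n - 1)) (h : i.val + 1 < j.val ∨ j.val + 1 < i.val) :
    tlImage f i * tlImage f j = tlImage f j * tlImage f i := by
  have h1 : Commute (f (Tmk (q ^ 2) (Qp q m) (Qp q m)⁻¹ n i))
      (f (Tmk (q ^ 2) (Qp q m) (Qp q m)⁻¹ n j)) :=
    Commute.map (Tmk_comm _ _ _ _ i j h) f
  exact commute_tlImage f (commute_tlImage f h1.symm).symm

theorem tlImage_idemImage_comm (hq : q ≠ 0) (hn : 2 ≤ n) (i : Fin (n - 1)) (h : 1 ≤ i.val) :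
    tlImage f i * idemImage hn f = idemImage hn f * tlImage f i := by
  have h1 : Commute (f (Tmk (q ^ 2) (Qp q m) (Qp q m)⁻¹ n i))
      (f (Lmk (q ^ 2) (Qp q m) (Qp q m)⁻¹ n ⟨0, by omega⟩)) :=
    Commute.map (Tmk_Lmk_zero_comm (pow_ne_zero 2 hq) i h) f
  exact commute_tlImage f
    (((Algebra.commute_algebraMap_right _ _).sub_right h1).smul_right _)

theorem idemImage_sq (hq : q ≠ 0) (hQ1 : (Qp q m) ^ 2 ≠ 1) (hn : 2 ≤ n) :
    idemImage hn f * idemImage hn f = idemImage hn f := by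
  have hQQ := Qp_sub_inv_ne_zero hq hQ1
  have h := congrArg f (Lmk_cyclo (q ^ 2) (Qp q m) (Qp q m)⁻¹ n ⟨0, by omega⟩ rfl)
  simp only [map_mul, map_sub, map_zero, AlgHom.commutes, map_Lmk_zero f hn hq hQ1] at h
  have h2 : ((Qp q m - (Qp q m)⁻¹) ^ 2) • (idemImage hn f * idemImage hn f) =
      ((Qp q m - (Qp q m)⁻¹) ^ 2) • idemImage hn f := by
    rw [← sub_eq_zero, ← h]
    simp only [Algebra.algebraMap_eq_smul_one, sub_mul, mul_sub, smul_mul_assoc, mul_smul_comm,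
      one_mul, mul_one]
    module
  exact smul_right_injective A (pow_ne_zero 2 hQQ) h2

theorem tlImage_kills (hn : 2 ≤ n) {a d : ℂ} (hd : d ≠ 0)
    (h : f (d⁻¹ • ((Tmk (q ^ 2) (Qp q m) (Qp q m)⁻¹ n ⟨0, by omega⟩ -
        algebraMap ℂ _ (q ^ 2)) *
      (Lmk (q ^ 2) (Qp q m) (Qp q m)⁻¹ n ⟨0, by omega⟩ - algebraMap ℂ _ a) *
      (Lmk (q ^ 2) (Qp q m) (Qp q m)⁻¹ n ⟨1, by omega⟩ - algebraMap ℂ _ a))) = 0) :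
    tlImage f ⟨0, by omega⟩ *
      (f (Lmk (q ^ 2) (Qp q m) (Qp q m)⁻¹ n ⟨0, by omega⟩) - algebraMap ℂ _ a) *
      (f (Lmk (q ^ 2) (Qp q m) (Qp q m)⁻¹ n ⟨1, by omega⟩) - algebraMap ℂ _ a) = 0 := by
  rw [map_smul] at h
  have h1 := (smul_eq_zero.mp h).resolve_left (inv_ne_zero hd)
  simp only [map_mul, map_sub, AlgHom.commutes] at h1
  rw [tlImage, smul_mul_assoc, smul_mul_assoc, h1, smul_zero]

theorem tlImage_idemImage_tlImage (hq : q ≠ 0) (hq4 : q ^ 4 ≠ 1)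
    (hQ1 : (Qp q m) ^ 2 ≠ 1) (hQ2 : (Qp q m) ^ 2 ≠ q ^ 2) (hQ3 : q ^ 2 * (Qp q m) ^ 2 ≠ 1)
    (hn : 2 ≤ n) (h21 : f (e21 q m n hn) = 0) (h22 : f (e22 q m n hn) = 0) :
    tlImage f ⟨0, by omega⟩ * idemImage hn f * tlImage f ⟨0, by omega⟩ =
      (-(gauss q (m - 1) / gauss q m)) • tlImage f ⟨0, by omega⟩ := by
  have hQ : Qp q m ≠ 0 := zpow_ne_zero m hq
  have hQQ := Qp_sub_inv_ne_zero hq hQ1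
  have hq2 := one_add_q_sq_ne_zero hq4
  have hd1 : (Qp q m)⁻¹ - q ^ (-2 : ℤ) * Qp q m ≠ 0 := by
    intro h
    rw [zpow_neg] at h
    field_simp at h
    exact hQ2 (by linear_combination -h)
  have hd2 : Qp q m - q ^ (-2 : ℤ) * (Qp q m)⁻¹ ≠ 0 := by
    intro h
    rw [zpow_neg] at h
    field_simp at h
    exact hQ3 (by linear_combination h)
  have hQQ' : (Qp q m)⁻¹ - Qp q m ≠ 0 := by
    rw [← neg_sub]
    exact neg_ne_zero.mpr hQQ
  have k1 := tlImage_kills f hn (mul_ne_zero (mul_ne_zero hq2 hQQ) hd1) h21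
  have k2 := tlImage_kills f hn (mul_ne_zero (mul_ne_zero hq2 hQQ') hd2) h22
  have hL := congrArg f (Lmk_succ (l1 := Qp q m) (l2 := (Qp q m)⁻¹)
    (pow_ne_zero 2 hq) 0 (by omega : 0 + 1 < n))
  simp only [map_smul, map_mul, map_Tmk f hq] at hL
  have h := mul_mul_of_kills hq (sub_ne_zero.mp hQQ') (tlImage_sq f hq _) hL k1 k2
  have hQQ2 : (Qp q m) ^ 2 - 1 ≠ 0 := sub_ne_zero.mpr hQ1
  rw [idemImage, gauss_ratio hq hq4]
  simp only [Algebra.algebraMap_eq_smul_one, mul_sub, sub_mul, mul_smul_comm, smul_mul_assoc,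
    mul_one, h, tlImage_sq f hq]
  match_scalars
  field_simp
  ring

theorem tlImage_braid (hq : q ≠ 0) (i j : Fin (n - 1)) (h : j.val = i.val + 1) :
    tlImage f i * tlImage f j * tlImage f i - tlImage f i =
      tlImage f j * tlImage f i * tlImage f j - tlImage f j := by
  have h1 := congrArg f (Tmk_braid (q ^ 2) (Qp q m) (Qp q m)⁻¹ n i j h)
  simp only [map_mul, map_Tmk f hq] at h1
  exact tl_of_braid hq (tlImage_sq f hq i) (tlImage_sq f hq j) h1

theorem tlImage_mul_mul (hq : q ≠ 0) (hq4 : q ^ 4 ≠ 1)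
    (hQ1 : (Qp q m) ^ 2 ≠ 1) (hQ2 : (Qp q m) ^ 2 ≠ q ^ 2) (hQ3 : q ^ 2 * (Qp q m) ^ 2 ≠ 1)
    (hn : 2 ≤ n) (h21 : f (e21 q m n hn) = 0) (h22 : f (e22 q m n hn) = 0)
    (i : ℕ) (hi : i + 1 < n - 1) :
    tlImage f ⟨i, by omega⟩ * tlImage f ⟨i + 1, hi⟩ * tlImage f ⟨i, by omega⟩ =
      tlImage f ⟨i, by omega⟩ := by
  have hQ : Qp q m ≠ 0 := zpow_ne_zero m hq
  have hq2 := one_add_q_sq_ne_zero hq4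
  have hQQ2 : (Qp q m) ^ 2 - 1 ≠ 0 := sub_ne_zero.mpr hQ1
  induction i with
  | zero =>
    refine blob_tl_relation ?_ ?_ ?_ (tlImage_sq f hq _) (tlImage_sq f hq _)
      (tlImage_braid f hq _ _ rfl)
      (tlImage_idemImage_tlImage f hq hq4 hQ1 hQ2 hQ3 hn h21 h22)
      (idemImage_sq f hq hQ1 hn) (tlImage_idemImage_comm f hq hn _ le_rfl)
    · intro h
      field_simp at h
      exact hq2 (by linear_combination -h)
    · rw [gauss_ratio hq hq4]
      intro h
      field_simp at h
      apply hQ2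
      linear_combination -h
    · rw [gauss_ratio hq hq4]
      intro h
      field_simp at h
      apply hQ3
      linear_combination h
  | succ i ih =>
    have hT (j : ℕ) (hj : j < n - 1) := isUnit_of_quadratic (pow_ne_zero 2 hq)
      (Tmk_quadratic (q ^ 2) (Qp q m) (Qp q m)⁻¹ n ⟨j, hj⟩)
    refine tl_mul_mul_conj hq (fun x => q • x + algebraMap ℂ A (q ^ 2)) (fun _ => rfl)
      ?_ ?_ ?_ ?_ (ih (by omega)) <;> simp only [← map_Tmk f hq, ← map_mul]
    · exact (((hT _ _).mul (hT _ _)).mul (hT _ _)).map f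
    · rw [Tmk_braid _ _ _ _ _ _ rfl]
    · rw [Tmk_braid _ _ _ _ _ _ rfl]
    · rw [Tmk_comm _ _ _ _ _ _ (Or.inl (by simp))]

/-- The values on generators of a homomorphism from the blob algebra. -/
def blobGenImage (hn : 2 ≤ n) (f : Hm q m n →ₐ[ℂ] A) : BlobGen n → A
  | BlobGen.e => idemImage hn f
  | BlobGen.U i => tlImage f i

theorem blobGenImage_rel (hq : q ≠ 0) (hq4 : q ^ 4 ≠ 1)
    (hQ1 : (Qp q m) ^ 2 ≠ 1) (hQ2 : (Qp q m) ^ 2 ≠ q ^ 2) (hQ3 : q ^ 2 * (Qp q m) ^ 2 ≠ 1)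
    (hn : 2 ≤ n) (h21 : f (e21 q m n hn) = 0) (h22 : f (e22 q m n hn) = 0)
    ⦃x y : FreeAlgebra ℂ (BlobGen n)⦄ (h : BlobRel q m n x y) :
    FreeAlgebra.lift ℂ (blobGenImage hn f) x = FreeAlgebra.lift ℂ (blobGenImage hn f) y := by
  induction h <;> simp only [UF, eF, map_mul, map_smul, FreeAlgebra.lift_ι_apply, blobGenImage]
  case Usq i => exact tlImage_sq f hq i
  case UUU i j h =>
    obtain ⟨i, hi⟩ := i
    obtain ⟨j, hj⟩ := j
    rcases h with h | h <;> simp only at h <;> subst h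
    · exact tlImage_mul_mul f hq hq4 hQ1 hQ2 hQ3 hn h21 h22 i hj
    · have h1 := tlImage_braid f hq ⟨j, hj⟩ ⟨j + 1, hi⟩ rfl
      rw [tlImage_mul_mul f hq hq4 hQ1 hQ2 hQ3 hn h21 h22 j hi, sub_self] at h1
      exact sub_eq_zero.mp h1.symm
  case Ucomm i j h => exact tlImage_comm f i j h
  case UeU i h =>
    obtain ⟨i, hi⟩ := i
    simp only at h
    subst h
    exact tlImage_idemImage_tlImage f hq hq4 hQ1 hQ2 hQ3 hn h21 h22
  case ee => exact idemImage_sq f hq hQ1 hn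
  case Ue i h => exact tlImage_idemImage_comm f hq hn i h

theorem exists_comp_heckeToBlob (hq : q ≠ 0) (hq4 : q ^ 4 ≠ 1)
    (hQ1 : (Qp q m) ^ 2 ≠ 1) (hQ2 : (Qp q m) ^ 2 ≠ q ^ 2) (hQ3 : q ^ 2 * (Qp q m) ^ 2 ≠ 1)
    (hn : 2 ≤ n) (h21 : f (e21 q m n hn) = 0) (h22 : f (e22 q m n hn) = 0) :
    ∃ g : Blob q m n →ₐ[ℂ] A, g.comp (heckeToBlob hq hq4 hQ1) = f := by
  let g : Blob q m n →ₐ[ℂ] A := RingQuot.liftAlgHom ℂ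
    ⟨FreeAlgebra.lift ℂ (blobGenImage hn f),
      blobGenImage_rel f hq hq4 hQ1 hQ2 hQ3 hn h21 h22⟩
  have hgU (i : Fin (n - 1)) : g (Umk q m n i) = tlImage f i := by
    simp [g, Umk, UF, blobGenImage]
  have hge : g (emk q m n) = idemImage hn f := by
    simp [g, emk, eF, blobGenImage]
  refine ⟨g, algHom_Hcy_ext (pow_ne_zero 2 hq) (by omega) (fun i => ?_) ?_⟩
  · rw [AlgHom.comp_apply, heckeToBlob_T, blobT_of_lt i.isLt, map_add, map_smul, hgU,
      AlgHom.commutes, map_Tmk f hq]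
  · rw [AlgHom.comp_apply, heckeToBlob_L, blobL_zero_eq hq hq4, map_sub, map_smul, hge,
      AlgHom.commutes, map_Lmk_zero f hn hq hQ1]

end BlobToQuotient

theorem heckeToBlob_surjective {q : ℂ} {m : ℤ} {n : ℕ} (hq : q ≠ 0) (hq4 : q ^ 4 ≠ 1)
    (hQ1 : (Qp q m) ^ 2 ≠ 1) (hn : 2 ≤ n) :
    Function.Surjective (heckeToBlob (n := n) hq hq4 hQ1) := by
  have hQQ := Qp_sub_inv_ne_zero hq hQ1
  intro y
  obtain ⟨y, rfl⟩ := RingQuot.mkAlgHom_surjective ℂ (BlobRel q m n) y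
  rw [← AlgHom.mem_range]
  induction y using FreeAlgebra.induction with
  | grade0 c => rw [AlgHom.commutes]; exact Subalgebra.algebraMap_mem _ c
  | add a b ha hb => rw [map_add]; exact add_mem ha hb
  | mul a b ha hb => rw [map_mul]; exact mul_mem ha hb
  | grade1 x =>
    cases x with
    | e =>
      refine ⟨idemImage hn (AlgHom.id ℂ _), ?_⟩
      simp only [idemImage, AlgHom.coe_id, id_eq, AlgHom.toRingHom_eq_coe, RingHom.coe_coe,
        map_smul, map_sub, AlgHom.commutes, heckeToBlob_L]
      rw [blobL_zero_eq hq hq4, sub_sub_cancel, smul_smul, inv_mul_cancel₀ hQQ, one_smul]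
      rfl
    | U i =>
      refine ⟨tlImage (AlgHom.id ℂ _) i, ?_⟩
      simp only [tlImage, AlgHom.coe_id, id_eq, AlgHom.toRingHom_eq_coe, RingHom.coe_coe,
        map_smul, map_sub, AlgHom.commutes, heckeToBlob_T]
      rw [blobT_of_lt i.isLt, add_sub_cancel_right, smul_smul, inv_mul_cancel₀ hq, one_smul]
      rfl

theorem heckeToBlob_eq_zero_iff {q : ℂ} {m : ℤ} {n : ℕ} (hq : q ≠ 0) (hq4 : q ^ 4 ≠ 1)
    (hQ1 : (Qp q m) ^ 2 ≠ 1) (hQ2 : (Qp q m) ^ 2 ≠ q ^ 2) (hQ3 : q ^ 2 * (Qp q m) ^ 2 ≠ 1)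
    (hn : 2 ≤ n) (x : Hm q m n) :
    heckeToBlob hq hq4 hQ1 x = 0 ↔ x ∈ TwoSidedIdeal.span {e21 q m n hn, e22 q m n hn} := by
  constructor
  · intro hx
    let I := TwoSidedIdeal.span {e21 q m n hn, e22 q m n hn}
    let π : Hm q m n →ₐ[ℂ] I.ringCon.Quotient :=
      { I.ringCon.mk' with commutes' := fun _ => rfl }
    have hπ (y : Hm q m n) : π y = 0 ↔ y ∈ I := by
      rw [TwoSidedIdeal.mem_iff]
      exact RingCon.eq I.ringCon
    obtain ⟨g, hg⟩ := exists_comp_heckeToBlob π hq hq4 hQ1 hQ2 hQ3 hn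
      ((hπ _).mpr (TwoSidedIdeal.subset_span (by simp)))
      ((hπ _).mpr (TwoSidedIdeal.subset_span (by simp)))
    rw [← hπ, ← hg, AlgHom.comp_apply, hx, map_zero]
  · intro hx
    rw [← TwoSidedIdeal.mem_ker]
    refine TwoSidedIdeal.span_le.mpr ?_ hx
    rintro _ (rfl | rfl)
    · exact (TwoSidedIdeal.mem_ker _).mpr (heckeToBlob_e21 hq hq4 hQ1 hn)
    · exact (TwoSidedIdeal.mem_ker _).mpr (heckeToBlob_e22 hq hq4 hQ1 hn)

theorem nonempty_quotient_algEquiv_blob {q : ℂ} {m : ℤ} {n : ℕ} (hq : q ≠ 0) (hq4 : q ^ 4 ≠ 1)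
    (hQ1 : (Qp q m) ^ 2 ≠ 1) (hQ2 : (Qp q m) ^ 2 ≠ q ^ 2) (hQ3 : q ^ 2 * (Qp q m) ^ 2 ≠ 1)
    (hn : 2 ≤ n) :
    Nonempty
      ((RingQuot fun a b : Hm q m n =>
          b = 0 ∧ (a = e21 q m n hn ∨ a = e22 q m n hn)) ≃ₐ[ℂ] Blob q m n) := by
  let R := fun a b : Hm q m n => b = 0 ∧ (a = e21 q m n hn ∨ a = e22 q m n hn)
  let π : Hm q m n →ₐ[ℂ] RingQuot R := RingQuot.mkAlgHom ℂ R
  have h21 : π (e21 q m n hn) = 0 :=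
    (RingQuot.mkAlgHom_rel ℂ (s := R) ⟨rfl, Or.inl rfl⟩).trans (map_zero π)
  have h22 : π (e22 q m n hn) = 0 :=
    (RingQuot.mkAlgHom_rel ℂ (s := R) ⟨rfl, Or.inr rfl⟩).trans (map_zero π)
  obtain ⟨g, hg⟩ := exists_comp_heckeToBlob (A := RingQuot R) π hq hq4 hQ1 hQ2 hQ3 hn h21 h22
  let p : RingQuot R →ₐ[ℂ] Blob q m n := RingQuot.liftAlgHom ℂ
    ⟨heckeToBlob hq hq4 hQ1, by
      rintro a b ⟨rfl, rfl | rfl⟩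
      · rw [heckeToBlob_e21, map_zero]
      · rw [heckeToBlob_e22, map_zero]⟩
  have hp (x : Hm q m n) : p (π x) = heckeToBlob hq hq4 hQ1 x :=
    RingQuot.liftAlgHom_mkAlgHom_apply ..
  have hg' (x : Hm q m n) : g (heckeToBlob hq hq4 hQ1 x) = π x := DFunLike.congr_fun hg x
  refine ⟨AlgEquiv.ofAlgHom p g ?_ ?_⟩
  · apply AlgHom.ext
    intro y
    obtain ⟨x, rfl⟩ := heckeToBlob_surjective hq hq4 hQ1 hn y
    rw [AlgHom.comp_apply, hg', hp, AlgHom.id_apply]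
  · apply AlgHom.ext
    intro y
    obtain ⟨x, rfl⟩ := RingQuot.mkAlgHom_surjective ℂ R y
    exact (congrArg g (hp x)).trans (hg' x)

/-- Under the conditions `q⁴ ≠ 1`, `Q² ≠ 1`, `Q² ≠ q²` and `q²Q² ≠ 1`
(with `Q = q^m`), there is a unique `ℂ`-algebra homomorphism
`Φ : H_n(q²; Q, Q⁻¹) → b_n(m)` with `Φ(T_i) = qU_i + q²` and
`Φ(L₁) = (q - q⁻¹)U₀ + q^m`; it is surjective, its kernel is the two-sided ideal `J_n`
generated by `e₂⁻¹` and `e₂⁻²`, and hence it induces an isomorphism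
`H_n(q²; Q, Q⁻¹)/J_n ≅ b_n(m)`. -/
theorem statement4 (q : ℂ) (m : ℤ) (hq : q ≠ 0) (hq4 : q ^ 4 ≠ 1)
    (hQ1 : (Qp q m) ^ 2 ≠ 1) (hQ2 : (Qp q m) ^ 2 ≠ q ^ 2)
    (hQ3 : q ^ 2 * (Qp q m) ^ 2 ≠ 1) (n : ℕ) (hn : 2 ≤ n) :
    ∃ Φ : Hm q m n →ₐ[ℂ] Blob q m n,
      (∀ i : Fin (n - 1),
        Φ (Tmk (q ^ 2) (Qp q m) (Qp q m)⁻¹ n i) = q • Umk q m n i + algebraMap ℂ _ (q ^ 2)) ∧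
      (Φ (Lmk (q ^ 2) (Qp q m) (Qp q m)⁻¹ n ⟨0, by omega⟩) =
        (q - q⁻¹) • U0el q m n + algebraMap ℂ _ (q ^ m)) ∧
      Function.Surjective Φ ∧
      (∀ x : Hm q m n,
        Φ x = 0 ↔ x ∈ TwoSidedIdeal.span {e21 q m n hn, e22 q m n hn}) ∧
      Nonempty
        ((RingQuot fun a b : Hm q m n =>
            b = 0 ∧ (a = e21 q m n hn ∨ a = e22 q m n hn)) ≃ₐ[ℂ] Blob q m n) ∧
      (∀ Ψ : Hm q m n →ₐ[ℂ] Blob q m n,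
        (∀ i : Fin (n - 1),
          Ψ (Tmk (q ^ 2) (Qp q m) (Qp q m)⁻¹ n i) =
            q • Umk q m n i + algebraMap ℂ _ (q ^ 2)) →
        (Ψ (Lmk (q ^ 2) (Qp q m) (Qp q m)⁻¹ n ⟨0, by omega⟩) =
          (q - q⁻¹) • U0el q m n + algebraMap ℂ _ (q ^ m)) →
        Ψ = Φ) := by
  refine ⟨heckeToBlob hq hq4 hQ1, fun i => ?_, heckeToBlob_L hq hq4 hQ1 _,
    heckeToBlob_surjective hq hq4 hQ1 hn, heckeToBlob_eq_zero_iff hq hq4 hQ1 hQ2 hQ3 hn,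
    nonempty_quotient_algEquiv_blob hq hq4 hQ1 hQ2 hQ3 hn, fun Ψ hT hL => ?_⟩
  · rw [heckeToBlob_T, blobT_of_lt i.isLt]
  · refine algHom_Hcy_ext (pow_ne_zero 2 hq) (by omega) (fun i => ?_) ?_
    · rw [hT, heckeToBlob_T, blobT_of_lt i.isLt]
    · rw [hL, heckeToBlob_L]
      rfl

end Statement4
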